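/- Fix an integer n ≥ 1 and take uniform edge weights φ ≡ 1, so that Z_T = |T| and Z_D = |D|. Then Z_T/Z_D = ((n+1)/n)^(n−1) < e; equivalently, under the uniform distribution over spanning trees, the probability that a sampled spanning tree is a valid single-root dependency tree equals (n/(n+1))^(n−1) > 1/e. (Hence on uniformly weighted graphs WilsonReject needs on average fewer than e draws before obtaining a valid dependency tree.) -/

import Mathlib

open Finset
open scoped Classical

noncomputable section

/-- One step of following head pointers: ROOT (node 0) maps to itself,
word node `i+1` maps to its head `t i`. -/
def step {n : ℕ} (t : Fin n → Fin (n + 1)) : Fin (n + 1) → Fin (n + 1) :=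
  Fin.cases 0 (fun i => t i)

/-- A parent assignment is a spanning tree iff from every node, repeatedly
following heads eventually reaches the ROOT node 0. -/
def IsSpanningTree {n : ℕ} (t : Fin n → Fin (n + 1)) : Prop :=
  ∀ v : Fin (n + 1), ∃ k : ℕ, (step t)^[k] v = 0

/-- A dependency tree is a spanning tree where exactly one word has head ROOT. -/
def IsDepTree {n : ℕ} (t : Fin n → Fin (n + 1)) : Prop :=
  IsSpanningTree t ∧ ∃! i : Fin n, t i = 0

/-- Weight of a tree: product of weights of its edges, `φ j i` is the weight
of the edge from head node `j` to word node `i`. -/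
def treeWeight {n : ℕ} (φ : Fin (n + 1) → Fin n → ℝ) (t : Fin n → Fin (n + 1)) : ℝ :=
  ∏ i : Fin n, φ (t i) i

/-- Partition function over spanning trees. -/
def ZT {n : ℕ} (φ : Fin (n + 1) → Fin n → ℝ) : ℝ :=
  ∑ t ∈ univ.filter (fun t : Fin n → Fin (n + 1) => IsSpanningTree t), treeWeight φ t

/-- Partition function over single-root dependency trees. -/
def ZD {n : ℕ} (φ : Fin (n + 1) → Fin n → ℝ) : ℝ :=
  ∑ t ∈ univ.filter (fun t : Fin n → Fin (n + 1) => IsDepTree t), treeWeight φ t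

/-- Total weight of dependency trees whose root word is `r` (root edge ROOT → r). -/
def rootMass {n : ℕ} (φ : Fin (n + 1) → Fin n → ℝ) (r : Fin n) : ℝ :=
  ∑ t ∈ univ.filter (fun t : Fin n → Fin (n + 1) => IsDepTree t ∧ t r = 0), treeWeight φ t

/-- A parent assignment `t` has no nonempty subset of `A` closed under taking heads, where words are
viewed as nodes through `e`. -/
def IsAcyclicOn {ι α : Type*} (e : ι ↪ α) (t : ι → α) (A : Finset ι) : Prop :=
  ∀ B ⊆ A, (∀ b ∈ B, t b ∈ B.map e) → B = ∅

/-- Assignments that are acyclic on `A`, send `A` into `A ∪ R`, and are constrained by `D`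
outside `A`. -/
def forests {ι α : Type*} [Fintype ι] [DecidableEq ι] [DecidableEq α] (e : ι ↪ α)
    (A : Finset ι) (R : Finset α) (D : ι → Finset α) : Finset (ι → α) :=
  (Fintype.piFinset (A.piecewise (fun _ => A.map e ∪ R) D)).filter (fun t => IsAcyclicOn e t A)

/-- The number of forests on `v` labelled vertices hanging from `r` given roots. -/
def forestCount : ℕ → ℕ → ℕ
  | 0, _ => 1
  | v + 1, r => r * (r + (v + 1)) ^ v

theorem forestCount_mul_add (v r : ℕ) : forestCount v r * (r + v) = r * (r + v) ^ v := by
  cases v with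
  | zero => simp [forestCount]
  | succ v => simp only [forestCount]; ring

/-- Recursion on the set of vertices attached directly to the roots. -/
theorem sum_choose_mul_forestCount (v r : ℕ) :
    ∑ k ∈ range (v + 1), v.choose k * (forestCount (v - k) k * r ^ k) = forestCount v r := by
  cases v with
  | zero => simp [forestCount]
  | succ w =>
    rw [sum_range_succ']
    have hterm : ∀ k ∈ range (w + 1),
        (w + 1).choose (k + 1) * (forestCount (w + 1 - (k + 1)) (k + 1) * r ^ (k + 1)) =
          r * (r ^ k * (w + 1) ^ (w - k) * w.choose k) := by
      intro k hk
      have hkw : k ≤ w := by simpa [Nat.lt_succ_iff] using hk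
      have h₁ := forestCount_mul_add (w - k) (k + 1)
      rw [show k + 1 + (w - k) = w + 1 by omega] at h₁
      have h₂ := Nat.add_one_mul_choose_eq w k
      rw [Nat.add_sub_add_right]
      apply Nat.eq_of_mul_eq_mul_right (Nat.succ_pos w)
      calc (w + 1).choose (k + 1) * (forestCount (w - k) (k + 1) * r ^ (k + 1)) * (w + 1)
          = (w + 1).choose (k + 1) * (forestCount (w - k) (k + 1) * (w + 1)) * r ^ (k + 1) := by
            ring
        _ = ((w + 1).choose (k + 1) * (k + 1)) * (w + 1) ^ (w - k) * r ^ (k + 1) := by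
            rw [h₁]; ring
        _ = r * (r ^ k * (w + 1) ^ (w - k) * w.choose k) * (w + 1) := by
            rw [← h₂]; ring
    rw [sum_congr rfl hterm, ← mul_sum]
    have hbinom := add_pow r (w + 1) w
    simp only [Nat.cast_id] at hbinom
    rw [← hbinom]
    simp [forestCount]

section Forests

variable {ι α : Type*} [Fintype ι] [DecidableEq ι] [DecidableEq α] {e : ι ↪ α}

theorem mem_forests {A : Finset ι} {R : Finset α} {D : ι → Finset α} {t : ι → α} :
    t ∈ forests e A R D ↔
      ((∀ a ∈ A, t a ∈ A.map e ∪ R) ∧ ∀ a ∉ A, t a ∈ D a) ∧ IsAcyclicOn e t A := by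
  rw [forests, mem_filter, Fintype.mem_piFinset]
  refine and_congr_left fun _ => ⟨fun h => ⟨fun a ha => ?_, fun a ha => ?_⟩, fun h a => ?_⟩
  · simpa [ha] using h a
  · simpa [ha] using h a
  · by_cases ha : a ∈ A
    · simpa [ha] using h.1 a ha
    · simpa [ha] using h.2 a ha

theorem forests_empty_roots {A : Finset ι} (hA : A.Nonempty) (D : ι → Finset α) :
    forests e A ∅ D = ∅ := by
  refine eq_empty_of_forall_notMem fun t ht => ?_
  rw [mem_forests] at ht
  exact hA.ne_empty (ht.2 A Subset.rfl fun b hb => by simpa using ht.1.1 b hb)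

/-- Forests whose set of vertices attached directly to `R` is `S` are forests rooted at `S`. -/
theorem filter_forests_eq {A S : Finset ι} {R : Finset α} (hR : Disjoint (A.map e) R) (hS : S ⊆ A)
    (D : ι → Finset α) :
    (forests e A R D).filter (fun t => A.filter (fun a => t a ∈ R) = S) =
      forests e (A \ S) (S.map e) (S.piecewise (fun _ => R) D) := by
  ext t
  rw [mem_filter, mem_forests, mem_forests, ← map_union, sdiff_union_of_subset hS]
  constructor
  · rintro ⟨⟨⟨h₁, h₂⟩, h₃⟩, rfl⟩
    refine ⟨⟨fun a ha => ?_, fun a ha => ?_⟩, fun B hB => h₃ B (hB.trans sdiff_subset)⟩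
    · have := h₁ a (mem_sdiff.1 ha).1
      simp only [mem_sdiff, mem_filter, not_and] at ha
      exact (mem_union.1 this).resolve_right (ha.2 ha.1)
    · by_cases haA : a ∈ A
      · have haR : t a ∈ R := by simpa [haA] using ha
        simp [haA, haR]
      · simpa [haA] using h₂ a haA
  · rintro ⟨⟨h₁, h₂⟩, h₃⟩
    have hSR : ∀ a ∈ S, t a ∈ R := fun a ha => by simpa [ha] using h₂ a (by simp [ha])
    have hAS : ∀ a ∈ A, t a ∈ R → a ∈ S := fun a ha haR => by
      by_contra haS
      exact disjoint_left.1 hR (h₁ a (mem_sdiff.2 ⟨ha, haS⟩)) haR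
    refine ⟨⟨⟨fun a ha => ?_, fun a ha => ?_⟩, fun B hB hBt => h₃ B (fun b hb => ?_) hBt⟩, ?_⟩
    · by_cases haS : a ∈ S
      · exact mem_union_right _ (hSR a haS)
      · exact mem_union_left _ (h₁ a (mem_sdiff.2 ⟨ha, haS⟩))
    · have haS : a ∉ S := fun h => ha (hS h)
      simpa [haS] using h₂ a (by simp [ha])
    · exact mem_sdiff.2 ⟨hB hb, fun hbS =>
        disjoint_left.1 hR (map_subset_map.2 hB (hBt b hb)) (hSR b hbS)⟩
    · ext a
      rw [mem_filter]
      exact ⟨fun h => hAS a h.1 h.2, fun h => ⟨hS h, hSR a h⟩⟩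

theorem card_forests {A : Finset ι} {R : Finset α} (hR : Disjoint (A.map e) R)
    (D : ι → Finset α) :
    #(forests e A R D) = forestCount #A #R * ∏ a ∈ Aᶜ, #(D a) := by
  induction A using Finset.strongInduction generalizing R D with
  | H A ih =>
    rcases A.eq_empty_or_nonempty with rfl | hA
    · simp [forests, IsAcyclicOn, forestCount, Fintype.card_piFinset]
    have hfiber : ∀ S ∈ A.powerset,
        #((forests e A R D).filter (fun t => A.filter (fun a => t a ∈ R) = S)) =
          forestCount (#A - #S) #S * #R ^ #S * ∏ a ∈ Aᶜ, #(D a) := by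
      intro S hS
      rw [mem_powerset] at hS
      rw [filter_forests_eq hR hS]
      rcases S.eq_empty_or_nonempty with rfl | hS'
      · obtain ⟨v, hv⟩ := Nat.exists_eq_succ_of_ne_zero hA.card_pos.ne'
        simp [forests_empty_roots hA, hv, forestCount]
      · have hdisj : Disjoint ((A \ S).map e) (S.map e) :=
          (disjoint_map e).2 sdiff_disjoint
        have hcompl : (A \ S)ᶜ = S ∪ Aᶜ := by
          ext a; by_cases a ∈ A <;> simp [*]
        have hdisj' : Disjoint S Aᶜ := disjoint_left.2 fun a ha h => mem_compl.1 h (hS ha)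
        rw [ih _ (sdiff_ssubset hS hS') hdisj, card_map, card_sdiff_of_subset hS, hcompl,
          prod_union hdisj', mul_assoc]
        congr 2
        · rw [prod_congr rfl fun a ha => by rw [piecewise_eq_of_mem _ _ _ ha], prod_const]
        · refine prod_congr rfl fun a ha => ?_
          rw [piecewise_eq_of_notMem _ _ _ fun h => mem_compl.1 ha (hS h)]
    rw [card_eq_sum_card_fiberwise (f := fun t => A.filter (fun a => t a ∈ R)) (t := A.powerset)
      (fun t _ => mem_coe.2 (mem_powerset.2 (filter_subset _ _))), sum_congr rfl hfiber, ← sum_mul,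
      sum_powerset_apply_card (fun k => forestCount (#A - k) k * #R ^ k)]
    simp only [smul_eq_mul]
    rw [sum_choose_mul_forestCount]

end Forests

section Trees

variable {n : ℕ}

theorem isSpanningTree_iff_isAcyclicOn (t : Fin n → Fin (n + 1)) :
    IsSpanningTree t ↔ IsAcyclicOn (Fin.succEmb n) t univ := by
  constructor
  · intro h B _ hB
    refine eq_empty_of_forall_notMem fun b hb => ?_
    have hinv : ∀ k, (step t)^[k] b.succ ∈ B.map (Fin.succEmb n) := by
      intro k
      induction k with
      | zero => simpa using hb
      | succ k ih =>
        rw [Function.iterate_succ_apply']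
        obtain ⟨c, hc, hck⟩ := mem_map.1 ih
        rw [← hck]
        exact hB c hc
    obtain ⟨k, hk⟩ := h b.succ
    have := hinv k
    rw [hk] at this
    obtain ⟨c, -, hc⟩ := mem_map.1 this
    exact Fin.succ_ne_zero c hc
  · intro h
    have hB := h (univ.filter fun b => ∀ k, (step t)^[k] b.succ ≠ 0) (subset_univ _) (by
      intro b hb
      have hb' : ∀ k, (step t)^[k] b.succ ≠ 0 := (mem_filter.1 hb).2
      obtain ⟨c, hc⟩ := Fin.exists_succ_eq.2 (show t b ≠ 0 from hb' 1)
      refine mem_map.2 ⟨c, mem_filter.2 ⟨mem_univ _, fun k => ?_⟩, hc⟩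
      rw [hc]
      exact hb' (k + 1))
    intro v
    cases v using Fin.cases with
    | zero => exact ⟨0, rfl⟩
    | succ b =>
      by_contra hv
      push Not at hv
      exact notMem_empty b (hB ▸ mem_filter.2 ⟨mem_univ _, hv⟩)

theorem filter_isSpanningTree_eq_forests :
    univ.filter (fun t : Fin n → Fin (n + 1) => IsSpanningTree t) =
      forests (Fin.succEmb n) univ {0} (fun _ => ∅) := by
  ext t
  rw [mem_filter, mem_forests, isSpanningTree_iff_isAcyclicOn]
  refine ⟨fun h => ⟨⟨fun a _ => ?_, by simp⟩, h.2⟩, fun h => ⟨mem_univ _, h.2⟩⟩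
  cases t a using Fin.cases <;> simp

theorem disjoint_map_succEmb_zero : Disjoint (univ.map (Fin.succEmb n)) {0} := by
  simp [Fin.succ_ne_zero]

/-- Cayley's formula. -/
theorem card_spanningTrees (hn : 1 ≤ n) :
    #(univ.filter (fun t : Fin n → Fin (n + 1) => IsSpanningTree t)) = (n + 1) ^ (n - 1) := by
  rw [filter_isSpanningTree_eq_forests, card_forests disjoint_map_succEmb_zero]
  obtain ⟨m, rfl⟩ := Nat.exists_eq_add_of_le' hn
  simp [forestCount, add_comm]

theorem card_depTrees (hn : 1 ≤ n) :
    #(univ.filter (fun t : Fin n → Fin (n + 1) => IsDepTree t)) = n ^ (n - 1) := by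
  have hsplit : univ.filter (fun t : Fin n → Fin (n + 1) => IsDepTree t) =
      univ.biUnion fun r : Fin n =>
        (forests (Fin.succEmb n) univ {0} (fun _ => ∅)).filter
          (fun t => univ.filter (fun a => t a ∈ ({0} : Finset (Fin (n + 1)))) = {r}) := by
    ext t
    rw [mem_filter]
    simp only [← filter_isSpanningTree_eq_forests, mem_filter, mem_biUnion, mem_univ, true_and,
      IsDepTree, exists_and_left, mem_singleton, Finset.ext_iff]
    refine and_congr_right fun _ => exists_congr fun r => ?_
    exact ⟨fun h a => ⟨h.2 a, fun ha => ha ▸ h.1⟩, fun h => ⟨(h r).2 rfl, fun a => (h a).1⟩⟩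
  rw [hsplit, card_biUnion fun r _ s _ hrs => disjoint_filter.2 fun t _ hr hs =>
    hrs (singleton_injective (hr.symm.trans hs))]
  have hfiber : ∀ r ∈ (univ : Finset (Fin n)),
      #((forests (Fin.succEmb n) univ {0} (fun _ => ∅)).filter
          (fun t => univ.filter (fun a => t a ∈ ({0} : Finset (Fin (n + 1)))) = {r})) =
        forestCount (n - 1) 1 := by
    intro r _
    have hdisj : Disjoint ((univ \ {r}).map (Fin.succEmb n))
        (({r} : Finset (Fin n)).map (Fin.succEmb n)) := (disjoint_map _).2 sdiff_disjoint
    rw [filter_forests_eq disjoint_map_succEmb_zero (subset_univ _), card_forests hdisj,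
      card_sdiff_of_subset (subset_univ _)]
    have hcompl : (univ \ {r} : Finset (Fin n))ᶜ = {r} := by ext; simp
    simp [hcompl]
  rw [sum_congr rfl hfiber, sum_const, card_univ, Fintype.card_fin, smul_eq_mul]
  have h := forestCount_mul_add (n - 1) 1
  rw [Nat.add_sub_of_le hn, one_mul] at h
  rw [mul_comm, h]

theorem ZT_one (hn : 1 ≤ n) :
    ZT (fun (_ : Fin (n + 1)) (_ : Fin n) => (1 : ℝ)) = ((n : ℝ) + 1) ^ (n - 1) := by
  simp [ZT, treeWeight, card_spanningTrees hn]

theorem ZD_one (hn : 1 ≤ n) :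
    ZD (fun (_ : Fin (n + 1)) (_ : Fin n) => (1 : ℝ)) = (n : ℝ) ^ (n - 1) := by
  simp [ZD, treeWeight, card_depTrees hn]

end Trees

theorem succ_div_pow_lt_exp_one {n : ℕ} (hn : 1 ≤ n) :
    (((n : ℝ) + 1) / (n : ℝ)) ^ (n - 1) < Real.exp 1 := by
  have hpos : (0 : ℝ) < n := by exact_mod_cast hn
  have hone : 1 ≤ ((n : ℝ) + 1) / n := by rw [le_div_iff₀ hpos]; linarith
  calc (((n : ℝ) + 1) / n) ^ (n - 1) ≤ (((n : ℝ) + 1) / n) ^ n :=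
        pow_le_pow_right₀ hone (Nat.sub_le _ _)
    _ < Real.exp (1 / n) ^ n := by
        refine pow_lt_pow_left₀ ?_ (by positivity) (by omega)
        rw [add_div, div_self hpos.ne', add_comm]
        exact Real.add_one_lt_exp (by positivity)
    _ = Real.exp 1 := by
        rw [← Real.exp_nat_mul, mul_one_div_cancel hpos.ne']

/-- **WilsonReject on uniformly weighted graphs.** With uniform edge weights `φ ≡ 1`,
`Z_T/Z_D = ((n+1)/n)^(n−1) < e`, and the probability that a uniformly sampled spanning
tree is a valid single-root dependency tree is `Z_D/Z_T = (n/(n+1))^(n−1) > 1/e`. -/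
theorem wilsonReject_uniform_weights {n : ℕ} (hn : 1 ≤ n) :
    ZT (fun (_ : Fin (n + 1)) (_ : Fin n) => (1 : ℝ)) /
        ZD (fun (_ : Fin (n + 1)) (_ : Fin n) => (1 : ℝ)) =
      (((n : ℝ) + 1) / (n : ℝ)) ^ (n - 1) ∧
    ZT (fun (_ : Fin (n + 1)) (_ : Fin n) => (1 : ℝ)) /
        ZD (fun (_ : Fin (n + 1)) (_ : Fin n) => (1 : ℝ)) < Real.exp 1 ∧
    ZD (fun (_ : Fin (n + 1)) (_ : Fin n) => (1 : ℝ)) /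
        ZT (fun (_ : Fin (n + 1)) (_ : Fin n) => (1 : ℝ)) =
      ((n : ℝ) / ((n : ℝ) + 1)) ^ (n - 1) ∧
    ZD (fun (_ : Fin (n + 1)) (_ : Fin n) => (1 : ℝ)) /
        ZT (fun (_ : Fin (n + 1)) (_ : Fin n) => (1 : ℝ)) > (Real.exp 1)⁻¹ := by
  have hpos : (0 : ℝ) < n := by exact_mod_cast hn
  have hlt := succ_div_pow_lt_exp_one hn
  rw [ZT_one hn, ZD_one hn, ← div_pow, ← div_pow]
  refine ⟨rfl, hlt, rfl, ?_⟩
  rw [gt_iff_lt, ← inv_div, inv_pow]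
  exact inv_strictAnti₀ (by positivity) hlt

end
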